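/- Let n ≥ 2, F = x_1x_2(y_1^2 + ... + y_n^2), and I(𝕏) = ({Y_iY_j}_{1≤i<j≤n}, X_1^2 − Y_1^2 − ... − Y_{n-1}^2 + (n−1)Y_n^2, X_1^2 − X_2^2) ⊂ T = ℂ[X_1,X_2,Y_1,...,Y_n]. Then I(𝕏) ⊆ F^⊥ and I(𝕏) is the vanishing ideal of a set of exactly 4n distinct points of ℙ^{n+1}; hence the Waring rank of F is at most 4n. -/

import Mathlib

open MvPolynomial
open scoped Classical

/-- Differentiation of `F` by the monomial with exponent vector `m`:
`∂^m F`, defined coefficientwise via descending factorials. -/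
noncomputable def contract {σ : Type*} (m : σ →₀ ℕ) (F : MvPolynomial σ ℂ) : MvPolynomial σ ℂ :=
  ∑ k ∈ F.support, monomial (k - m) (F.coeff k * m.prod fun i e => (Nat.descFactorial (k i) e : ℂ))

/-- The apolarity (differentiation) action: `apolar g F = g ∘ F`. -/
noncomputable def apolar {σ : Type*} (g F : MvPolynomial σ ℂ) : MvPolynomial σ ℂ :=
  ∑ m ∈ g.support, g.coeff m • contract m F

/-- Homogeneous vanishing ideal of a set of projective points: all polynomials
vanishing on the corresponding lines through the origin. -/
noncomputable def projVanishingIdeal {σ : Type*} (S : Set (Projectivization ℂ (σ → ℂ))) :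
    Ideal (MvPolynomial σ ℂ) :=
  ⨅ P ∈ S, ⨅ c : ℂ, RingHom.ker (MvPolynomial.eval (c • P.rep))

/-- The Waring rank of a degree-`d` form `F`: the least `r` such that `F` is a
linear combination of `r` `d`-th powers of linear forms. -/
noncomputable def waringRank {σ : Type*} [Fintype σ] (d : ℕ) (F : MvPolynomial σ ℂ) : ℕ :=
  sInf {r | ∃ c : Fin r → ℂ, ∃ L : Fin r → σ → ℂ,
    F = ∑ i, MvPolynomial.C (c i) * (∑ j, MvPolynomial.C (L i j) * X j) ^ d}

open scoped Polynomial

lemma contract_monomial {σ : Type*} (m k : σ →₀ ℕ) (a : ℂ) :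
    contract m (monomial k a) =
      monomial (k - m) (a * m.prod fun i e => (Nat.descFactorial (k i) e : ℂ)) := by
  unfold contract
  rcases eq_or_ne a 0 with rfl | ha
  · simp
  · rw [support_monomial, if_neg ha]
    simp

lemma contract_eq_sum_of_support_subset {σ : Type*} (m : σ →₀ ℕ) (F : MvPolynomial σ ℂ)
    {s : Finset (σ →₀ ℕ)} (hs : F.support ⊆ s) :
    contract m F = ∑ k ∈ s, contract m (monomial k (F.coeff k)) := by
  simp only [contract_monomial]
  refine Finset.sum_subset hs fun k _ hk => ?_
  rw [notMem_support_iff.mp hk]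
  simp

lemma contract_add {σ : Type*} (m : σ →₀ ℕ) (F G : MvPolynomial σ ℂ) :
    contract m (F + G) = contract m F + contract m G := by
  rw [contract_eq_sum_of_support_subset m F (Finset.subset_union_left (s₂ := G.support)),
    contract_eq_sum_of_support_subset m G (Finset.subset_union_right (s₁ := F.support)),
    contract_eq_sum_of_support_subset m (F + G) support_add, ← Finset.sum_add_distrib]
  refine Finset.sum_congr rfl fun k _ => ?_
  rw [coeff_add, contract_monomial, contract_monomial, contract_monomial, add_mul, map_add]

lemma contract_smul {σ : Type*} (m : σ →₀ ℕ) (c : ℂ) (F : MvPolynomial σ ℂ) :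
    contract m (c • F) = c • contract m F := by
  rw [contract_eq_sum_of_support_subset m (c • F) support_smul,
    contract_eq_sum_of_support_subset m F subset_rfl, Finset.smul_sum]
  simp only [contract_monomial, coeff_smul, smul_monomial, smul_eq_mul, mul_assoc]

lemma contract_contract {σ : Type*} (m m' : σ →₀ ℕ) (F : MvPolynomial σ ℂ) :
    contract m' (contract m F) = contract (m + m') F := by
  induction F using MvPolynomial.induction_on' with
  | add p q hp hq => simp only [contract_add, hp, hq]
  | monomial k a =>
    simp only [contract_monomial, mul_assoc, tsub_tsub]
    congr 2
    have hsub : ∀ u ∈ ({m, m', m + m'} : Set (σ →₀ ℕ)), u.support ⊆ m.support ∪ m'.support := by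
      rintro u (rfl | rfl | rfl)
      · exact Finset.subset_union_left
      · exact Finset.subset_union_right
      · exact Finsupp.support_add
    rw [Finsupp.prod_of_support_subset m (hsub _ (by simp)) _ (by simp),
      Finsupp.prod_of_support_subset m' (hsub _ (by simp)) _ (by simp),
      Finsupp.prod_of_support_subset (m + m') (hsub _ (by simp)) _ (by simp),
      ← Finset.prod_mul_distrib]
    refine Finset.prod_congr rfl fun i _ => ?_
    rw [← Nat.cast_mul]
    congr 1
    simp only [Finsupp.coe_tsub, Pi.sub_apply, Finsupp.coe_add, Pi.add_apply]
    rw [mul_comm, ← Nat.descFactorial_mul_descFactorial (Nat.le_add_right (m i) (m' i)),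
      Nat.add_sub_cancel_left]

lemma apolar_eq_sum_of_support_subset {σ : Type*} (g F : MvPolynomial σ ℂ)
    {s : Finset (σ →₀ ℕ)} (hs : g.support ⊆ s) :
    apolar g F = ∑ m ∈ s, g.coeff m • contract m F := by
  refine Finset.sum_subset hs fun k _ hk => ?_
  rw [notMem_support_iff.mp hk, zero_smul]

lemma apolar_add_left {σ : Type*} (g h F : MvPolynomial σ ℂ) :
    apolar (g + h) F = apolar g F + apolar h F := by
  rw [apolar_eq_sum_of_support_subset g F (Finset.subset_union_left (s₂ := h.support)),
    apolar_eq_sum_of_support_subset h F (Finset.subset_union_right (s₁ := g.support)),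
    apolar_eq_sum_of_support_subset (g + h) F support_add, ← Finset.sum_add_distrib]
  simp only [coeff_add, add_smul]

lemma apolar_monomial {σ : Type*} (m : σ →₀ ℕ) (c : ℂ) (F : MvPolynomial σ ℂ) :
    apolar (monomial m c) F = c • contract m F := by
  rw [apolar_eq_sum_of_support_subset _ F support_monomial_subset]
  simp

lemma apolar_smul_left {σ : Type*} (c : ℂ) (g F : MvPolynomial σ ℂ) :
    apolar (c • g) F = c • apolar g F := by
  rw [apolar_eq_sum_of_support_subset (c • g) F support_smul,
    apolar_eq_sum_of_support_subset g F subset_rfl, Finset.smul_sum]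
  simp only [coeff_smul, smul_eq_mul, mul_smul]

/-- `g ↦ apolar g F` as a linear map. -/
noncomputable def apolarLinear {σ : Type*} (F : MvPolynomial σ ℂ) :
    MvPolynomial σ ℂ →ₗ[ℂ] MvPolynomial σ ℂ where
  toFun g := apolar g F
  map_add' g h := apolar_add_left g h F
  map_smul' c g := apolar_smul_left c g F

lemma apolarLinear_apply {σ : Type*} (F g : MvPolynomial σ ℂ) :
    apolarLinear F g = apolar g F := rfl

lemma contract_apolar {σ : Type*} (m : σ →₀ ℕ) (g F : MvPolynomial σ ℂ) :
    contract m (apolar g F) = apolar (monomial m 1 * g) F := by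
  induction g using MvPolynomial.induction_on' with
  | add p q hp hq => rw [apolar_add_left, contract_add, hp, hq, mul_add, apolar_add_left]
  | monomial k a =>
    rw [monomial_mul, one_mul, apolar_monomial, apolar_monomial, contract_smul,
      contract_contract, add_comm]

lemma apolar_mul {σ : Type*} (h g F : MvPolynomial σ ℂ) :
    apolar (h * g) F = apolar h (apolar g F) := by
  induction h using MvPolynomial.induction_on' with
  | add p q hp hq => rw [add_mul, apolar_add_left, hp, hq, apolar_add_left]
  | monomial k a =>
    have : monomial k a * g = a • (monomial k 1 * g) := by
      rw [← smul_mul_assoc, smul_monomial, smul_eq_mul, mul_one]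
    rw [this, apolar_smul_left, apolar_monomial, contract_apolar]

lemma apolar_X {σ : Type*} (i : σ) (F : MvPolynomial σ ℂ) : apolar (X i) F = pderiv i F := by
  rw [X, apolar_monomial, one_smul]
  induction F using MvPolynomial.induction_on' with
  | add p q hp hq => rw [contract_add, hp, hq, map_add]
  | monomial k a => simp [contract_monomial, pderiv_monomial]

lemma apolar_zero_right {σ : Type*} (g : MvPolynomial σ ℂ) : apolar g 0 = 0 := by
  simp [apolar, contract]

/-- The annihilator of `F` under the apolarity action. -/
noncomputable def apolarAnnihilator {σ : Type*} (F : MvPolynomial σ ℂ) :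
    Ideal (MvPolynomial σ ℂ) where
  carrier := {g | apolar g F = 0}
  add_mem' {g h} hg hh := by
    simp only [Set.mem_ofPred_eq] at hg hh ⊢
    rw [apolar_add_left, hg, hh, add_zero]
  zero_mem' := (apolarLinear F).map_zero
  smul_mem' h g hg := by
    simp only [Set.mem_ofPred_eq] at hg ⊢
    rw [smul_eq_mul, apolar_mul, hg, apolar_zero_right]

lemma mem_apolarAnnihilator {σ : Type*} {F g : MvPolynomial σ ℂ} :
    g ∈ apolarAnnihilator F ↔ apolar g F = 0 := Iff.rfl

lemma coeff_aeval_single {ι : Type*} [DecidableEq ι] (k : ι) (d : ℕ) (g : MvPolynomial ι ℂ) :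
    (aeval (Pi.single k (Polynomial.X : ℂ[X])) g).coeff d =
      g.coeff (Finsupp.single k d) := by
  induction g using MvPolynomial.induction_on' with
  | add p q hp hq => rw [map_add, Polynomial.coeff_add, hp, hq, coeff_add]
  | monomial m c =>
    rw [aeval_monomial, coeff_monomial]
    by_cases h : ∃ i, i ≠ k ∧ m i ≠ 0
    · obtain ⟨i, hik, hi⟩ := h
      have h0 : (m.prod fun i e => (Pi.single k (Polynomial.X : ℂ[X]) : ι → ℂ[X]) i ^ e) = 0 :=
        Finset.prod_eq_zero (Finsupp.mem_support_iff.mpr hi) (by simp [hik, hi])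
      have h1 : m ≠ Finsupp.single k d := by
        rintro rfl
        exact hi (by simp [hik.symm])
      simp [h0, h1]
    · push Not at h
      obtain ⟨e, rfl⟩ : ∃ e, m = Finsupp.single k e := by
        refine ⟨m k, Finsupp.ext fun i => ?_⟩
        rcases eq_or_ne i k with rfl | hi
        · simp
        · rw [h i hi, Finsupp.single_apply, if_neg hi.symm]
      rw [Finsupp.prod_single_index (by simp)]
      simp [Polynomial.coeff_X_pow, Polynomial.algebraMap_eq, eq_comm,
        (Finsupp.single_injective k).eq_iff]

/-- A polynomial vanishing on all coordinate axes lies in the ideal generated by the products of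
two distinct variables. -/
lemma mem_span_mul_of_eval_axes {ι : Type*} [LinearOrder ι] [Nonempty ι] (g : MvPolynomial ι ℂ)
    (hg : ∀ (k : ι) (c : ℂ), c ≠ 0 → eval (Pi.single k c) g = 0) :
    g ∈ Ideal.span {p : MvPolynomial ι ℂ | ∃ i j, i < j ∧ p = X i * X j} := by
  have hcoeff : ∀ (k : ι) (d : ℕ), g.coeff (Finsupp.single k d) = 0 := by
    intro k d
    have h0 : aeval (Pi.single k (Polynomial.X : ℂ[X])) g = 0 := by
      refine Polynomial.eq_zero_of_infinite_isRoot _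
        (Set.Infinite.mono (s := {0}ᶜ) (fun c hc => ?_) (Set.finite_singleton 0).infinite_compl)
      have hev : ((Polynomial.aeval c).comp (aeval (Pi.single k (Polynomial.X : ℂ[X])))) =
          (aeval (Pi.single k c) : MvPolynomial ι ℂ →ₐ[ℂ] ℂ) := by
        ext i
        rcases eq_or_ne i k with rfl | hi
        · simp
        · simp [hi]
      have := DFunLike.congr_fun hev g
      rw [AlgHom.comp_apply, Polynomial.coe_aeval_eq_eval] at this
      exact this.trans (hg k c hc)
    rw [← coeff_aeval_single, h0, Polynomial.coeff_zero]
  rw [g.as_sum]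
  refine Ideal.sum_mem _ fun m hm => ?_
  obtain ⟨i, j, hij, hi, hj⟩ : ∃ i j, i < j ∧ m i ≠ 0 ∧ m j ≠ 0 := by
    by_contra! h
    have hne : ∀ i j, i ≠ j → m i ≠ 0 → m j = 0 := by
      intro i j hij hi
      rcases lt_or_gt_of_ne hij with h' | h'
      · exact h i j h' hi
      · by_contra hj
        exact hi (h j i h' hj)
    obtain ⟨k, hk⟩ : ∃ k, ∀ i, i ≠ k → m i = 0 := by
      by_cases h0 : ∃ k, m k ≠ 0
      · obtain ⟨k, hk⟩ := h0
        exact ⟨k, fun i hi => hne k i hi.symm hk⟩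
      · push Not at h0
        exact ⟨Classical.arbitrary ι, fun i _ => h0 i⟩
    have hmk : m = Finsupp.single k (m k) := by
      ext i
      rcases eq_or_ne i k with rfl | hi
      · simp
      · rw [hk i hi, Finsupp.single_apply, if_neg hi.symm]
    rw [hmk, mem_support_iff] at hm
    exact hm (hcoeff k _)
  have hle : Finsupp.single i 1 + Finsupp.single j 1 ≤ m := by
    intro u
    simp only [Finsupp.coe_add, Pi.add_apply, Finsupp.single_apply]
    split_ifs with h1 h2 h2
    · exact absurd (h1.trans h2.symm) hij.ne
    · subst h1; omega
    · subst h2; omega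
    · omega
  have hfac : monomial m (g.coeff m) =
      monomial (m - (Finsupp.single i 1 + Finsupp.single j 1)) (g.coeff m) * (X i * X j) := by
    rw [X, X, monomial_mul, monomial_mul, tsub_add_cancel_of_le hle]
    simp
  rw [hfac]
  exact Ideal.mul_mem_left _ _ (Ideal.subset_span ⟨i, j, hij, rfl⟩)

lemma mem_projVanishingIdeal_range {σ τ : Type*} (v : τ → σ → ℂ) (hv : ∀ p, v p ≠ 0)
    (f : MvPolynomial σ ℂ) :
    f ∈ projVanishingIdeal (Set.range fun p => Projectivization.mk ℂ (v p) (hv p)) ↔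
      ∀ p (c : ℂ), eval (c • v p) f = 0 := by
  simp only [projVanishingIdeal, Ideal.mem_iInf, Set.forall_mem_range, RingHom.mem_ker]
  refine forall_congr' fun p => ?_
  obtain ⟨u, hu⟩ := Projectivization.exists_smul_eq_mk_rep ℂ (v p) (hv p)
  rw [← hu]
  constructor
  · intro h c
    have := h (c * (u⁻¹ : ℂˣ))
    rwa [Units.smul_def, smul_smul, mul_assoc, Units.inv_mul, mul_one] at this
  · intro h c
    rw [Units.smul_def, smul_smul]
    exact h _

lemma waringRank_le_card {σ τ : Type*} [Fintype σ] [Fintype τ] (d : ℕ) (F : MvPolynomial σ ℂ)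
    (c : τ → ℂ) (L : τ → σ → ℂ) (h : F = ∑ i, C (c i) * (∑ j, C (L i j) * X j) ^ d) :
    waringRank d F ≤ Fintype.card τ := by
  refine Nat.sInf_le ⟨c ∘ (Fintype.equivFin τ).symm, L ∘ (Fintype.equivFin τ).symm, ?_⟩
  rw [h, ← (Fintype.equivFin τ).symm.sum_comp]
  rfl

/-- The representative `(± s_k, ± s_k, e_k)` of a zero of `axesIdeal (s ^ 2)`. -/
noncomputable def axesPoint {ι : Type*} [DecidableEq ι] (s : ι → ℂ) (p : Fin 2 × Fin 2 × ι) :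
    Fin 2 ⊕ ι → ℂ :=
  Sum.elim ![(-1) ^ (p.1 : ℕ) * s p.2.2, (-1) ^ (p.2.1 : ℕ) * s p.2.2] (Pi.single p.2.2 1)

lemma axesPoint_ne_zero {ι : Type*} [DecidableEq ι] (s : ι → ℂ) (p : Fin 2 × Fin 2 × ι) :
    axesPoint s p ≠ 0 := fun h => by
  simpa [axesPoint] using congrFun h (Sum.inr p.2.2)

lemma mk_axesPoint_injective {ι : Type*} [DecidableEq ι] (s : ι → ℂ)
    (hs : ∀ k, s k ≠ 0) :
    Function.Injective fun p => Projectivization.mk ℂ (axesPoint s p) (axesPoint_ne_zero s p) := by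
  rintro ⟨e, f, k⟩ ⟨e', f', k'⟩ h
  obtain ⟨u, hu⟩ := (Projectivization.mk_eq_mk_iff' ℂ _ _ _ _).mp h
  have hk := congrFun hu (Sum.inr k)
  obtain rfl : k = k' := by
    by_contra hne
    simp [axesPoint, hne] at hk
  obtain rfl : u = 1 := by simpa [axesPoint] using hk
  have h0 := congrFun hu (Sum.inl 0)
  have h1 := congrFun hu (Sum.inl 1)
  have hsign : ∀ x y : Fin 2, (-1 : ℂ) ^ (x : ℕ) = (-1) ^ (y : ℕ) → y = x := by
    intro x y
    fin_cases x <;> fin_cases y <;> norm_num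
  simp only [axesPoint, one_smul, Sum.elim_inl, Matrix.cons_val_zero, Matrix.cons_val_one,
    mul_eq_mul_right_iff, hs, or_false] at h0 h1
  rw [hsign _ _ h0, hsign _ _ h1]

/-- The ideal generated by all `Y_i Y_j` with `i < j`, by `X_1^2 - ∑ a_j Y_j^2` and by
`X_1^2 - X_2^2`. -/
noncomputable def axesIdeal {ι : Type*} [Fintype ι] [LinearOrder ι] (a : ι → ℂ) :
    Ideal (MvPolynomial (Fin 2 ⊕ ι) ℂ) :=
  Ideal.span ({p | ∃ i j : ι, i < j ∧ p = X (Sum.inr i) * X (Sum.inr j)} ∪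
    {X (Sum.inl 0) ^ 2 - ∑ j, C (a j) * X (Sum.inr j) ^ 2,
      X (Sum.inl 0) ^ 2 - X (Sum.inl 1) ^ 2})

section axes

variable {ι : Type*} [Fintype ι] [LinearOrder ι]

lemma mul_mem_axesIdeal (a : ι → ℂ) {i j : ι} (h : i < j) :
    X (Sum.inr i) * X (Sum.inr j) ∈ axesIdeal a :=
  Ideal.subset_span (Or.inl ⟨i, j, h, rfl⟩)

lemma sq_sub_sum_mem_axesIdeal (a : ι → ℂ) :
    X (Sum.inl 0) ^ 2 - ∑ j, C (a j) * X (Sum.inr j) ^ 2 ∈ axesIdeal a :=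
  Ideal.subset_span (Or.inr (Or.inl rfl))

lemma sq_sub_sq_mem_axesIdeal (a : ι → ℂ) :
    X (Sum.inl 0) ^ 2 - X (Sum.inl 1) ^ 2 ∈ axesIdeal a :=
  Ideal.subset_span (Or.inr (Or.inr rfl))

lemma exists_sub_mem_axesIdeal (a : ι → ℂ) (f : MvPolynomial (Fin 2 ⊕ ι) ℂ) :
    ∃ g₀ g₁ g₂ g₃ : MvPolynomial ι ℂ,
      f - (rename Sum.inr g₀ + X (Sum.inl 0) * rename Sum.inr g₁ +
        X (Sum.inl 1) * rename Sum.inr g₂ +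
        X (Sum.inl 0) * X (Sum.inl 1) * rename Sum.inr g₃) ∈ axesIdeal a := by
  induction f using MvPolynomial.induction_on with
  | C c => exact ⟨C c, 0, 0, 0, by simp⟩
  | add p q hp hq =>
    obtain ⟨g₀, g₁, g₂, g₃, hg⟩ := hp
    obtain ⟨h₀, h₁, h₂, h₃, hh⟩ := hq
    refine ⟨g₀ + h₀, g₁ + h₁, g₂ + h₂, g₃ + h₃, ?_⟩
    convert add_mem hg hh using 1
    simp only [map_add]
    ring
  | mul_X p i hp =>
    obtain ⟨g₀, g₁, g₂, g₃, hg⟩ := hp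
    have h0 := sq_sub_sum_mem_axesIdeal a
    have h1 := sq_sub_sq_mem_axesIdeal a
    have hb : rename Sum.inr (∑ j, C (a j) * X j ^ 2 : MvPolynomial ι ℂ) =
        (∑ j, C (a j) * X (Sum.inr j) ^ 2 : MvPolynomial (Fin 2 ⊕ ι) ℂ) := by
      simp
    rw [← hb] at h0
    generalize (∑ j, C (a j) * X j ^ 2 : MvPolynomial ι ℂ) = b at h0
    rcases i with i | i
    · fin_cases i
      · refine ⟨b * g₁, g₀, b * g₃, g₂, ?_⟩
        convert add_mem (Ideal.mul_mem_left _ (X (Sum.inl 0)) hg)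
          (Ideal.mul_mem_left _ (rename Sum.inr g₁ + X (Sum.inl 1) * rename Sum.inr g₃) h0) using 1
        simp only [map_mul, Fin.zero_eta]
        ring
      · refine ⟨b * g₂, b * g₃, g₀, g₁, ?_⟩
        convert add_mem (Ideal.mul_mem_left _ (X (Sum.inl 1)) hg)
          (Ideal.mul_mem_left _ (rename Sum.inr g₂ + X (Sum.inl 0) * rename Sum.inr g₃)
            (sub_mem h0 h1)) using 1
        simp only [map_mul, Fin.mk_one]
        ring
    · refine ⟨X i * g₀, X i * g₁, X i * g₂, X i * g₃, ?_⟩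
      convert Ideal.mul_mem_left _ (X (Sum.inr i)) hg using 1
      simp only [map_mul, rename_X]
      ring

lemma rename_mem_axesIdeal [Nonempty ι] (a : ι → ℂ) (g : MvPolynomial ι ℂ)
    (hg : ∀ (k : ι) (c : ℂ), c ≠ 0 → eval (Pi.single k c) g = 0) :
    rename Sum.inr g ∈ axesIdeal a := by
  suffices Ideal.span {p : MvPolynomial ι ℂ | ∃ i j, i < j ∧ p = X i * X j} ≤
      (axesIdeal a).comap (rename Sum.inr) from this (mem_span_mul_of_eval_axes g hg)
  rw [Ideal.span_le]
  rintro _ ⟨i, j, hij, rfl⟩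
  simpa using mul_mem_axesIdeal a hij

lemma mem_axesIdeal_iff [Nonempty ι] (s : ι → ℂ) (hs : ∀ k, s k ≠ 0)
    (f : MvPolynomial (Fin 2 ⊕ ι) ℂ) :
    f ∈ axesIdeal (fun k => s k ^ 2) ↔ ∀ p (c : ℂ), eval (c • axesPoint s p) f = 0 := by
  have hvan : ∀ f ∈ axesIdeal (fun k => s k ^ 2), ∀ p (c : ℂ), eval (c • axesPoint s p) f = 0 := by
    intro f hf p c
    rw [← RingHom.mem_ker]
    refine (Ideal.span_le (I := RingHom.ker (eval (c • axesPoint s p)))).mpr ?_ hf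
    obtain ⟨e, e', k⟩ := p
    have hsq : ∀ x : Fin 2, ((-1 : ℂ) ^ (x : ℕ)) ^ 2 = 1 := by
      intro x
      rw [← pow_mul, mul_comm, pow_mul, neg_one_sq, one_pow]
    rintro _ (⟨i, j, hij, rfl⟩ | rfl | rfl)
    · rcases eq_or_ne i k with rfl | hi
      · simp [axesPoint, hij.ne']
      · simp [axesPoint, hi]
    · simp [axesPoint, mul_pow, hsq, Pi.single_apply, ite_pow]
      ring
    · simp [axesPoint, mul_pow, hsq]
  refine ⟨hvan f, fun hf => ?_⟩
  obtain ⟨g₀, g₁, g₂, g₃, hg⟩ := exists_sub_mem_axesIdeal (fun k => s k ^ 2) f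
  have hzero : ∀ (k : ι) (c : ℂ), c ≠ 0 →
      eval (Pi.single k c) g₀ = 0 ∧ eval (Pi.single k c) g₁ = 0 ∧
      eval (Pi.single k c) g₂ = 0 ∧ eval (Pi.single k c) g₃ = 0 := by
    intro k c hc
    have hcomp : ∀ e e' : Fin 2, (c • axesPoint s (e, e', k)) ∘ Sum.inr = Pi.single k c := by
      intro e e'
      ext i
      simp [axesPoint, Pi.single_apply]
    have key : ∀ e e' : Fin 2, eval (Pi.single k c) g₀ +
        (c * ((-1) ^ (e : ℕ) * s k)) * eval (Pi.single k c) g₁ +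
        (c * ((-1) ^ (e' : ℕ) * s k)) * eval (Pi.single k c) g₂ +
        (c * ((-1) ^ (e : ℕ) * s k)) * (c * ((-1) ^ (e' : ℕ) * s k)) *
          eval (Pi.single k c) g₃ = 0 := by
      intro e e'
      have h := hvan _ hg (e, e', k) c
      rw [map_sub, hf, zero_sub, neg_eq_zero] at h
      simp only [map_add, map_mul, eval_rename, hcomp, eval_X] at h
      simpa [axesPoint] using h
    have h00 := key 0 0
    have h01 := key 0 1
    have h10 := key 1 0
    have h11 := key 1 1
    simp only [Fin.val_zero, Fin.val_one, pow_zero, pow_one] at h00 h01 h10 h11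
    have hcs : c * s k ≠ 0 := mul_ne_zero hc (hs k)
    refine ⟨?_, ?_, ?_, ?_⟩
    · linear_combination (h00 + h01 + h10 + h11) / 4
    · refine (mul_eq_zero_iff_left hcs).mp ?_
      linear_combination (h00 + h01 - h10 - h11) / 4
    · refine (mul_eq_zero_iff_left hcs).mp ?_
      linear_combination (h00 - h01 + h10 - h11) / 4
    · refine (mul_eq_zero_iff_left (mul_ne_zero hcs hcs)).mp ?_
      linear_combination (h00 - h01 - h10 + h11) / 4
  have m₀ := rename_mem_axesIdeal (fun k => s k ^ 2) g₀ fun k c hc => (hzero k c hc).1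
  have m₁ := rename_mem_axesIdeal (fun k => s k ^ 2) g₁ fun k c hc => (hzero k c hc).2.1
  have m₂ := rename_mem_axesIdeal (fun k => s k ^ 2) g₂ fun k c hc => (hzero k c hc).2.2.1
  have m₃ := rename_mem_axesIdeal (fun k => s k ^ 2) g₃ fun k c hc => (hzero k c hc).2.2.2
  rw [← sub_add_cancel f]
  exact add_mem hg (add_mem (add_mem (add_mem m₀ (Ideal.mul_mem_left _ _ m₁))
    (Ideal.mul_mem_left _ _ m₂)) (Ideal.mul_mem_left _ _ m₃))

lemma exists_finset_axesIdeal_eq [Nonempty ι] (s : ι → ℂ) (hs : ∀ k, s k ≠ 0) :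
    ∃ S : Finset (Projectivization ℂ (Fin 2 ⊕ ι → ℂ)),
      S.card = 4 * Fintype.card ι ∧
        axesIdeal (fun k => s k ^ 2) = projVanishingIdeal (S : Set _) := by
  refine ⟨Finset.univ.map ⟨_, mk_axesPoint_injective s hs⟩, ?_, ?_⟩
  · rw [Finset.card_map, Finset.card_univ, Fintype.card_prod, Fintype.card_prod, Fintype.card_fin]
    ring
  · ext f
    rw [mem_axesIdeal_iff s hs, Finset.coe_map, Finset.coe_univ, Set.image_univ]
    exact (mem_projVanishingIdeal_range (axesPoint s) (axesPoint_ne_zero s) f).symm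

lemma axesIdeal_le_apolarAnnihilator (a : ι → ℂ) (ha : ∑ k, a k = 0) :
    axesIdeal a ≤ apolarAnnihilator
      (X (Sum.inl 0) * X (Sum.inl 1) * ∑ j, X (Sum.inr j) ^ 2) := by
  refine Ideal.span_le.mpr ?_
  have hX : ∀ i : Fin 2, apolar (X (Sum.inl i) ^ 2)
      (X (Sum.inl 0) * X (Sum.inl 1) * ∑ j : ι, X (Sum.inr j) ^ 2) = 0 := by
    intro i
    rw [sq, apolar_mul, apolar_X, apolar_X]
    fin_cases i <;> simp [pderiv_X]
  have hY : ∀ i j : ι, apolar (X (Sum.inr i) * X (Sum.inr j) : MvPolynomial (Fin 2 ⊕ ι) ℂ)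
      (X (Sum.inl 0) * X (Sum.inl 1) * ∑ j : ι, X (Sum.inr j) ^ 2) =
        if i = j then 2 * (X (Sum.inl 0) * X (Sum.inl 1)) else 0 := by
    intro i j
    rw [apolar_mul, apolar_X, apolar_X]
    have h2 : pderiv (Sum.inr i) (2 : MvPolynomial (Fin 2 ⊕ ι) ℂ) = 0 :=
      pderiv_C (a := (2 : ℂ))
    have hsum : pderiv (Sum.inr j) (∑ j : ι, X (Sum.inr j) ^ 2 : MvPolynomial (Fin 2 ⊕ ι) ℂ) =
        2 * X (Sum.inr j) := by
      simp [pderiv_X, Pi.single_apply]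
    rw [Derivation.leibniz, hsum]
    rcases eq_or_ne i j with rfl | hij
    · simp [h2]
      ring
    · simp [h2, hij, hij.symm, pderiv_X]
  rintro _ (⟨i, j, hij, rfl⟩ | rfl | rfl)
  · rw [SetLike.mem_coe, mem_apolarAnnihilator, hY, if_neg hij.ne]
  · rw [SetLike.mem_coe, mem_apolarAnnihilator, ← apolarLinear_apply, map_sub, map_sum]
    have hYsq : ∀ j : ι, apolar (X (Sum.inr j) ^ 2 : MvPolynomial (Fin 2 ⊕ ι) ℂ)
        (X (Sum.inl 0) * X (Sum.inl 1) * ∑ j : ι, X (Sum.inr j) ^ 2) =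
          2 * (X (Sum.inl 0) * X (Sum.inl 1)) := fun j => by
      rw [sq (X (Sum.inr j)), hY, if_pos rfl]
    simp only [← smul_eq_C_mul, map_smul, apolarLinear_apply, hX, hYsq]
    rw [← Finset.sum_smul, ha, zero_smul, sub_zero]
  · rw [SetLike.mem_coe, mem_apolarAnnihilator, ← apolarLinear_apply, map_sub,
      apolarLinear_apply, apolarLinear_apply, hX, hX, sub_zero]

lemma waringRank_le_of_sum_sq_eq_zero (s : ι → ℂ) (hs : ∀ k, s k ≠ 0) (hsum : ∑ k, s k ^ 2 = 0) :
    waringRank 4 (X (Sum.inl 0) * X (Sum.inl 1) * ∑ j, X (Sum.inr j) ^ 2 :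
      MvPolynomial (Fin 2 ⊕ ι) ℂ) ≤ 4 * Fintype.card ι := by
  have hcard : 4 * Fintype.card ι = Fintype.card (Fin 2 × Fin 2 × ι) := by
    rw [Fintype.card_prod, Fintype.card_prod, Fintype.card_fin]
    ring
  rw [hcard]
  refine waringRank_le_card 4 _
    (fun p => (-1) ^ (p.1 : ℕ) * (-1) ^ (p.2.1 : ℕ) * (48 * s p.2.2 ^ 2)⁻¹) (axesPoint s) ?_
  have hL : ∀ p : Fin 2 × Fin 2 × ι, (∑ j, C (axesPoint s p j) * X j) =
      C ((-1) ^ (p.1 : ℕ) * s p.2.2) * X (Sum.inl 0) +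
        C ((-1) ^ (p.2.1 : ℕ) * s p.2.2) * X (Sum.inl 1) + X (Sum.inr p.2.2) := by
    intro p
    simp [axesPoint, Fintype.sum_sum_type, Fin.sum_univ_two, Pi.single_apply]
  simp only [hL, Fintype.sum_prod_type, Fin.sum_univ_two, ← Finset.sum_add_distrib]
  have hterm : ∀ k : ι, ∀ x y z : MvPolynomial (Fin 2 ⊕ ι) ℂ,
      C (48 * s k ^ 2)⁻¹ * ((C (s k) * x + C (s k) * y + z) ^ 4
        - (C (s k) * x - C (s k) * y + z) ^ 4 - (-(C (s k) * x) + C (s k) * y + z) ^ 4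
        + (-(C (s k) * x) - C (s k) * y + z) ^ 4) =
      x * y * z ^ 2 + C (s k ^ 2) * (C (1 / 3) * (x ^ 3 * y + x * y ^ 3)) := by
    intro k x y z
    have h1 : (C (48 * s k ^ 2)⁻¹ * (48 * C (s k) ^ 2) : MvPolynomial (Fin 2 ⊕ ι) ℂ) = 1 := by
      rw [← C_pow, show (48 : MvPolynomial (Fin 2 ⊕ ι) ℂ) = C 48 from rfl, ← C_mul, ← C_mul,
        inv_mul_cancel₀ (by simp [hs k]), C_1]
    have h3 : (3 * C (1 / 3) : MvPolynomial (Fin 2 ⊕ ι) ℂ) = 1 := by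
      rw [show (3 : MvPolynomial (Fin 2 ⊕ ι) ℂ) = C 3 from rfl, ← C_mul]
      norm_num
    rw [C_pow]
    linear_combination (x * y * z ^ 2 +
      C (s k) ^ 2 * (C (1 / 3) * (x ^ 3 * y + x * y ^ 3))) * h1 -
      16 * C (48 * s k ^ 2)⁻¹ * C (s k) ^ 4 * (x ^ 3 * y + x * y ^ 3) * h3
  have hF : (X (Sum.inl 0) * X (Sum.inl 1) * ∑ j, X (Sum.inr j) ^ 2 :
      MvPolynomial (Fin 2 ⊕ ι) ℂ) = ∑ k, (X (Sum.inl 0) * X (Sum.inl 1) * X (Sum.inr k) ^ 2 +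
        C (s k ^ 2) * (C (1 / 3) * (X (Sum.inl 0) ^ 3 * X (Sum.inl 1) +
          X (Sum.inl 0) * X (Sum.inl 1) ^ 3))) := by
    rw [Finset.sum_add_distrib, ← Finset.mul_sum, ← Finset.sum_mul, ← map_sum, hsum]
    simp
  rw [hF]
  refine Finset.sum_congr rfl fun k _ => ?_
  rw [← hterm]
  simp only [Fin.val_zero, Fin.val_one, pow_zero, pow_one, one_mul, neg_mul, mul_neg, map_neg,
    neg_neg]
  ring

end axes

/-- For `n ≥ 2` and `F = x_1x_2(y_1^2 + ⋯ + y_n^2)`, the ideal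
`I = ({Y_iY_j}_{i<j}, X_1^2 − Y_1^2 − ⋯ − Y_{n-1}^2 + (n−1)Y_n^2, X_1^2 − X_2^2)` is
contained in `F^⊥` and is the vanishing ideal of a set of exactly `4n` distinct points of
`ℙ^{n+1}`; hence `rk F ≤ 4n`. -/
theorem statement12 (n : ℕ) (hn : 2 ≤ n) :
    let Y : Fin n → MvPolynomial (Fin 2 ⊕ Fin n) ℂ := fun j => X (Sum.inr j)
    let F : MvPolynomial (Fin 2 ⊕ Fin n) ℂ :=
      X (Sum.inl 0) * X (Sum.inl 1) * ∑ j, (Y j) ^ 2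
    let I : Ideal (MvPolynomial (Fin 2 ⊕ Fin n) ℂ) := Ideal.span
      ({p | ∃ i j : Fin n, i < j ∧ p = Y i * Y j} ∪
       {(X (Sum.inl 0)) ^ 2 -
          (∑ j ∈ Finset.univ.erase (⟨n - 1, by omega⟩ : Fin n), (Y j) ^ 2) +
          C ((n : ℂ) - 1) * (Y ⟨n - 1, by omega⟩) ^ 2,
        (X (Sum.inl 0)) ^ 2 - (X (Sum.inl 1)) ^ 2})
    (∀ g ∈ I, apolar g F = 0) ∧
    (∃ 𝕏 : Finset (Projectivization ℂ ((Fin 2 ⊕ Fin n) → ℂ)),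
      𝕏.card = 4 * n ∧ I = projVanishingIdeal ↑𝕏) ∧
    waringRank 4 F ≤ 4 * n := by
  intro Y F I
  have : Nonempty (Fin n) := ⟨⟨0, by omega⟩⟩
  set l : Fin n := ⟨n - 1, by omega⟩
  let a : Fin n → ℂ := fun k => if k = l then -((n : ℂ) - 1) else 1
  have hn1 : (n : ℂ) - 1 ≠ 0 := by
    rw [sub_ne_zero]
    exact_mod_cast (by omega : n ≠ 1)
  have ha : ∀ k, a k ≠ 0 := by
    intro k
    simp only [a]
    split_ifs
    exacts [neg_ne_zero.mpr hn1, one_ne_zero]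
  have herase : ∑ k ∈ Finset.univ.erase l, a k = (n : ℂ) - 1 := by
    rw [Finset.sum_congr rfl fun k hk => if_neg (Finset.ne_of_mem_erase hk), Finset.sum_const,
      Finset.card_erase_of_mem (Finset.mem_univ l), Finset.card_univ, Fintype.card_fin,
      nsmul_eq_mul, mul_one, Nat.cast_sub (by omega), Nat.cast_one]
  have hsum : ∑ k, a k = 0 := by
    rw [← Finset.add_sum_erase _ _ (Finset.mem_univ l), herase]
    simp [a]
  choose s hs using fun k => IsAlgClosed.exists_pow_nat_eq (a k) (n := 2) two_pos
  have hs0 : ∀ k, s k ≠ 0 := fun k h => ha k (by rw [← hs k, h]; simp)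
  have hsa : (fun k => s k ^ 2) = a := funext hs
  have hgen : (X (Sum.inl 0)) ^ 2 - (∑ j ∈ Finset.univ.erase l, (Y j) ^ 2) +
      C ((n : ℂ) - 1) * (Y l) ^ 2 = X (Sum.inl 0) ^ 2 - ∑ j, C (a j) * X (Sum.inr j) ^ 2 := by
    have h1 : ∑ j ∈ Finset.univ.erase l, C (a j) * X (Sum.inr j) ^ 2 =
        ∑ j ∈ Finset.univ.erase l, (Y j) ^ 2 :=
      Finset.sum_congr rfl fun k hk => by
        simp [a, Y, Finset.ne_of_mem_erase hk]
    rw [← Finset.add_sum_erase _ _ (Finset.mem_univ l), h1]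
    simp only [a, if_true, Y, map_neg]
    ring
  have hI : I = axesIdeal a := by
    simp only [I, axesIdeal, ← hgen, Y, l]
  refine ⟨fun g hg => ?_, ?_, ?_⟩
  · rw [hI] at hg
    exact axesIdeal_le_apolarAnnihilator a hsum hg
  · rw [hI, ← hsa]
    simpa using exists_finset_axesIdeal_eq s hs0
  · simpa using waringRank_le_of_sum_sq_eq_zero s hs0 (by simpa only [hs] using hsum)
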